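/- arXiv:0809.4887 — 2 statements merged into one kernel-verified Lean document; each statement's English description precedes it below -/
import Mathlib

section
/- Let m ≥ 5 be an integer with m ≡ 5 (mod 6) and let G be a doubly transitive subgroup of Perm(Fin m). Then every 2^{m−1}·G-equivariant 𝔽₃-linear endomorphism of the module W⁻ of odd functions X → 𝔽₃ is multiplication by a scalar in 𝔽₃; that is, the 𝔽₃-algebra of 2^{m−1}·G-equivariant endomorphisms of W⁻ equals 𝔽₃·id. -/
open Equiv Finset

namespace SignedPerm

variable {m : ℕ}

/-- The sign-flip involution ν on `Fin m × Bool`. -/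
def nu (m : ℕ) : Equiv.Perm (Fin m × Bool) where
  toFun p := (p.1, !p.2)
  invFun p := (p.1, !p.2)
  left_inv p := by simp
  right_inv p := by simp

/-- The signed permutation `(i,b) ↦ (s i, εᵢ · b)`, where `ε i = true` means sign flip. -/
def signedOf (s : Equiv.Perm (Fin m)) (ε : Fin m → Bool) : Equiv.Perm (Fin m × Bool) where
  toFun p := (s p.1, xor (ε p.1) p.2)
  invFun p := (s.symm p.1, xor (ε (s.symm p.1)) p.2)
  left_inv p := by simp [← Bool.xor_assoc]
  right_inv p := by simp [← Bool.xor_assoc]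

/-- The sign product `∏ᵢ εᵢ` of a system of signs (`true` = `-1`). -/
def signProd (ε : Fin m → Bool) : ℤˣ := ∏ i, if ε i then -1 else 1

lemma signedOf_one : signedOf (1 : Equiv.Perm (Fin m)) (fun _ => false) = 1 :=
  Equiv.ext fun p => by simp [signedOf]

lemma signedOf_mul (s t : Equiv.Perm (Fin m)) (ε η : Fin m → Bool) :
    signedOf s ε * signedOf t η = signedOf (s * t) (fun i => xor (ε (t i)) (η i)) :=
  Equiv.ext fun p => by simp [signedOf, Equiv.Perm.mul_apply, Bool.xor_assoc]

lemma signedOf_inv (s : Equiv.Perm (Fin m)) (ε : Fin m → Bool) :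
    (signedOf s ε)⁻¹ = signedOf s⁻¹ (fun i => ε (s⁻¹ i)) :=
  inv_eq_of_mul_eq_one_right <| by
    rw [signedOf_mul]
    simp [signedOf_one]

lemma signProd_const_false : signProd (fun _ : Fin m => false) = 1 := by simp [signProd]

lemma signProd_comp (t : Equiv.Perm (Fin m)) (ε : Fin m → Bool) :
    signProd (fun i => ε (t i)) = signProd ε := by
  simpa [signProd] using Equiv.prod_comp t (fun i => if ε i then (-1 : ℤˣ) else 1)

lemma signProd_xor (ε η : Fin m → Bool) :
    signProd (fun i => xor (ε i) (η i)) = signProd ε * signProd η := by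
  rw [signProd, signProd, signProd, ← Finset.prod_mul_distrib]
  refine Finset.prod_congr rfl fun i _ => ?_
  cases ε i <;> cases η i <;> simp

/-- The group `2^m · G` of all signed permutations with underlying permutation in `G`. -/
def bigSigned (G : Subgroup (Equiv.Perm (Fin m))) : Subgroup (Equiv.Perm (Fin m × Bool)) where
  carrier := {σ | ∃ s ∈ G, ∃ ε : Fin m → Bool, σ = signedOf s ε}
  one_mem' := ⟨1, G.one_mem, fun _ => false, signedOf_one.symm⟩
  mul_mem' := by
    rintro σ τ ⟨s, hs, ε, rfl⟩ ⟨t, ht, η, rfl⟩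
    exact ⟨s * t, G.mul_mem hs ht, _, (signedOf_mul s t ε η)⟩
  inv_mem' := by
    rintro σ ⟨s, hs, ε, rfl⟩
    exact ⟨s⁻¹, G.inv_mem hs, _, signedOf_inv s ε⟩

/-- The group `2^{m-1} · G` of signed permutations with underlying permutation in `G`
and sign product `1`. -/
def evenSigned (G : Subgroup (Equiv.Perm (Fin m))) : Subgroup (Equiv.Perm (Fin m × Bool)) where
  carrier := {σ | ∃ s ∈ G, ∃ ε : Fin m → Bool, σ = signedOf s ε ∧ signProd ε = 1}
  one_mem' := ⟨1, G.one_mem, fun _ => false, signedOf_one.symm, signProd_const_false⟩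
  mul_mem' := by
    rintro σ τ ⟨s, hs, ε, rfl, hε⟩ ⟨t, ht, η, rfl, hη⟩
    refine ⟨s * t, G.mul_mem hs ht, _, signedOf_mul s t ε η, ?_⟩
    rw [signProd_xor (fun i => ε (t i)) η, signProd_comp t ε, hε, hη, one_mul]
  inv_mem' := by
    rintro σ ⟨s, hs, ε, rfl, hε⟩
    exact ⟨s⁻¹, G.inv_mem hs, _, signedOf_inv s ε, by rw [signProd_comp s⁻¹ ε, hε]⟩

end SignedPerm

namespace SignedPerm

/-- The submodule `W⁻` of odd functions `X → 𝔽₃`. -/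
def Wminus (m : ℕ) : Submodule (ZMod 3) ((Fin m × Bool) → ZMod 3) where
  carrier := {φ | ∀ p, φ (nu m p) = - φ p}
  add_mem' := by
    intro a b ha hb p
    simp only [Pi.add_apply, ha p, hb p]
    ring
  zero_mem' := by intro p; simp
  smul_mem' := by
    intro c a ha p
    simp only [Pi.smul_apply, ha p, smul_eq_mul]
    ring

end SignedPerm

namespace SignedPerm

/-- The basis vector of `W⁻` supported at `(i, ±)`. -/
def bvec {m : ℕ} (i : Fin m) : Wminus m :=
  ⟨fun p => if p.1 = i then (if p.2 then -1 else 1) else 0, by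
    intro p
    rcases p with ⟨j, b⟩
    by_cases h : j = i <;> cases b <;> simp [nu, h]⟩

lemma bvec_apply {m : ℕ} (i : Fin m) (p : Fin m × Bool) :
    (bvec i : (Fin m × Bool) → ZMod 3) p = if p.1 = i then (if p.2 then -1 else 1) else 0 := rfl

lemma wm_true {m : ℕ} (φ : Wminus m) (i : Fin m) :
    (φ : (Fin m × Bool) → ZMod 3) (i, true) = - (φ : (Fin m × Bool) → ZMod 3) (i, false) :=
  φ.2 (i, false)

lemma wm_sum {m : ℕ} (φ : Wminus m) :
    φ = ∑ i, (φ : (Fin m × Bool) → ZMod 3) (i, false) • bvec i := by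
  apply Subtype.ext
  funext p
  rcases p with ⟨j, b⟩
  rw [Submodule.coe_sum, Finset.sum_apply]
  cases b <;> simp [bvec_apply, wm_true]

lemma exists_third {m : ℕ} (hm : 5 ≤ m) (i j : Fin m) : ∃ k, k ≠ i ∧ k ≠ j := by
  have h : ∃ k, k ∉ ({i, j} : Finset (Fin m)) := by
    by_contra hc
    push Not at hc
    have h1 : (Finset.univ : Finset (Fin m)) ⊆ {i, j} := fun k _ => hc k
    have h2 := Finset.card_le_card h1
    have h3 := Finset.card_le_two (a := i) (b := j)
    simp only [Finset.card_univ, Fintype.card_fin] at h2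
    omega
  simpa using h

lemma signProd_pair {m : ℕ} (j k : Fin m) (h : k ≠ j) :
    signProd (fun i => xor (decide (i = j)) (decide (i = k))) = 1 := by
  rw [signProd_xor (fun i => decide (i = j)) (fun i => decide (i = k))]
  simp [signProd, Finset.prod_ite_eq']

end SignedPerm

open SignedPerm in
/-- if `m ≥ 5`, `m ≡ 5 (mod 6)` and `G` is doubly transitive on `Fin m`, then
every `2^{m-1}·G`-equivariant 𝔽₃-linear endomorphism of the module `W⁻` of odd functions
`X → 𝔽₃` is multiplication by a scalar of `𝔽₃`. -/
theorem statement7 (m : ℕ) (hm : 5 ≤ m) (hmod : m % 6 = 5)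
    (G : Subgroup (Equiv.Perm (Fin m)))
    (hG : ∀ a b c d : Fin m, a ≠ b → c ≠ d → ∃ g ∈ G, g a = c ∧ g b = d)
    (T : Wminus m →ₗ[ZMod 3] Wminus m)
    (hT : ∀ σ ∈ evenSigned G, ∀ φ ψ : Wminus m,
        (∀ p, (ψ : (Fin m × Bool) → ZMod 3) p = (φ : (Fin m × Bool) → ZMod 3) (σ⁻¹ p)) →
        ∀ p, (T ψ : (Fin m × Bool) → ZMod 3) p = (T φ : (Fin m × Bool) → ZMod 3) (σ⁻¹ p)) :
    ∃ c : ZMod 3, ∀ φ : Wminus m, T φ = c • φ := by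
  have inv_apply : ∀ (s : Equiv.Perm (Fin m)) (ε : Fin m → Bool) (p : Fin m × Bool),
      (signedOf s ε)⁻¹ p = (s⁻¹ p.1, xor (ε (s⁻¹ p.1)) p.2) := fun _ _ _ => rfl
  -- off-diagonal entries vanish
  have off : ∀ i j : Fin m, j ≠ i → (T (bvec i) : (Fin m × Bool) → ZMod 3) (j, false) = 0 := by
    intro i j hji
    obtain ⟨k, hki, hkj⟩ := exists_third hm i j
    have key := hT (signedOf 1 (fun i => xor (decide (i = j)) (decide (i = k))))
      ⟨1, G.one_mem, _, rfl, signProd_pair j k hkj⟩ (bvec i) (bvec i) (by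
        rintro ⟨l, b⟩
        rw [inv_apply, bvec_apply, bvec_apply]
        by_cases hl : l = i
        · subst hl
          simp [Ne.symm hji, Ne.symm hki]
        · simp [hl]) (j, false)
    rw [inv_apply] at key
    simp only [inv_one, Equiv.Perm.one_apply, decide_true, Ne.symm hkj, decide_false,
      Bool.xor_false] at key
    rw [wm_true] at key
    generalize (T (bvec i) : (Fin m × Bool) → ZMod 3) (j, false) = x at key
    revert x
    decide
  -- diagonal entries agree
  have diag : ∀ i j : Fin m, (T (bvec j) : (Fin m × Bool) → ZMod 3) (j, false)
      = (T (bvec i) : (Fin m × Bool) → ZMod 3) (i, false) := by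
    intro i j
    obtain ⟨k, hki, -⟩ := exists_third hm i i
    obtain ⟨l, hlj, -⟩ := exists_third hm j j
    obtain ⟨g, hg, hgi, -⟩ := hG i k j l hki.symm hlj.symm
    have key := hT (signedOf g (fun _ => false)) ⟨g, hg, _, rfl, signProd_const_false⟩
      (bvec i) (bvec j) (by
        rintro ⟨l, b⟩
        rw [inv_apply, bvec_apply, bvec_apply]
        simp [Equiv.symm_apply_eq, hgi]) (j, false)
    rw [inv_apply] at key
    have hgj : g⁻¹ j = i := by rw [Equiv.Perm.inv_eq_iff_eq, hgi]
    simpa [hgj] using key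
  let i0 : Fin m := ⟨0, by omega⟩
  refine ⟨(T (bvec i0) : (Fin m × Bool) → ZMod 3) (i0, false), fun φ => ?_⟩
  have hb : ∀ i, T (bvec i) = (T (bvec i0) : (Fin m × Bool) → ZMod 3) (i0, false) • bvec i := by
    intro i
    rw [← diag i0 i]
    conv_lhs => rw [wm_sum (T (bvec i))]
    exact Finset.sum_eq_single i (fun j _ hj => by rw [off i j hj, zero_smul]) (by simp)
  rw [wm_sum φ, map_sum, Finset.smul_sum]
  refine Finset.sum_congr rfl fun i _ => ?_
  rw [map_smul, hb i, smul_comm]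
end

section
/- Assume that Gal(h) = 2^{m−1}·G for some doubly transitive subgroup G ≤ Perm(Fin m), i.e. the image of Gal(K̄/K) in Perm(R_h) equals the set of all permutations of the form βᵢ ↦ εᵢ β_{s(i)}, −βᵢ ↦ −εᵢ β_{s(i)} with s ∈ G, εᵢ ∈ {±1}, ∏ᵢεᵢ = 1. Then every Gal(K̄/K)-equivariant 𝔽₃-linear endomorphism of V_f^{−} is multiplication by a scalar in 𝔽₃. -/
open Equiv Finset

namespace SignedPerm

variable {m : ℕ} {F : Type*} [Field F]

/-- The root set `R_h = {±β₁, …, ±βₘ}`. -/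
def RhSet (β : Fin m → F) : Set F := {x | ∃ i, x = β i ∨ x = -β i}

/-- The root set `R_f = {0} ∪ {±β₁, …, ±βₘ}`. -/
def RfSet (β : Fin m → F) : Set F := insert 0 (RhSet β)

/-- The 𝔽₃-vector space `V_f⁻` of odd 𝔽₃-valued functions on `R_f`, realized as functions on
`F` vanishing off `R_f` and odd on `R_f`. -/
def VfMinus (β : Fin m → F) : Submodule (ZMod 3) (F → ZMod 3) where
  carrier := {φ | (∀ α ∉ RfSet β, φ α = 0) ∧ ∀ α ∈ RfSet β, φ (-α) = -φ α}
  add_mem' := by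
    rintro a b ⟨ha1, ha2⟩ ⟨hb1, hb2⟩
    refine ⟨fun α hα => by simp [ha1 α hα, hb1 α hα], fun α hα => ?_⟩
    simp only [Pi.add_apply, ha2 α hα, hb2 α hα]
    ring
  zero_mem' := ⟨fun α _ => rfl, fun α _ => by simp⟩
  smul_mem' := by
    rintro c a ⟨ha1, ha2⟩
    refine ⟨fun α hα => by simp [ha1 α hα], fun α hα => ?_⟩
    simp only [Pi.smul_apply, ha2 α hα, smul_eq_mul]
    ring

end SignedPerm

namespace SignedPerm

lemma zmod3_eq_zero_of_eq_neg (x : ZMod 3) (h : x = -x) : x = 0 := by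
  revert x; decide

lemma VfMinus_ext {m : ℕ} {F : Type*} [Field F] {β : Fin m → F} (φ ψ : VfMinus β)
    (h : ∀ i, (φ : F → ZMod 3) (β i) = (ψ : F → ZMod 3) (β i)) : φ = ψ := by
  have key : ∀ χ : VfMinus β, (χ : F → ZMod 3) 0 = 0 := by
    intro χ
    have h0 := χ.2.2 0 (Set.mem_insert _ _)
    rw [neg_zero] at h0
    exact zmod3_eq_zero_of_eq_neg _ h0
  apply Subtype.ext
  funext α
  by_cases hα : α ∈ RfSet β
  · rcases hα with rfl | ⟨i, rfl | rfl⟩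
    · rw [key, key]
    · exact h i
    · have hi : β i ∈ RfSet β := Or.inr ⟨i, Or.inl rfl⟩
      rw [φ.2.2 _ hi, ψ.2.2 _ hi, h i]
  · rw [φ.2.1 α hα, ψ.2.1 α hα]

open Classical in
/-- The basis vector of `V_f⁻` attached to `β i`. -/
noncomputable def eVec {m : ℕ} {F : Type*} [Field F] (β : Fin m → F)
    (hne : ∀ i j, β i ≠ -β j) (i : Fin m) : VfMinus β :=
  ⟨fun α => if α = β i then 1 else if α = -β i then -1 else 0, by
    constructor
    · intro α hα
      have h1 : α ≠ β i := fun h => hα (Or.inr ⟨i, Or.inl h⟩)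
      have h2 : α ≠ -β i := fun h => hα (Or.inr ⟨i, Or.inr h⟩)
      simp [h1, h2]
    · intro α _
      by_cases h1 : α = β i
      · subst h1
        simp [(hne i i).symm]
      · by_cases h2 : α = -β i
        · subst h2
          simp [h1]
        · have h3 : -α ≠ β i := fun h => h2 (by rw [← h, neg_neg])
          have h4 : -α ≠ -β i := fun h => h1 (neg_injective h)
          simp only [h1, h2, h3, h4, if_false, neg_zero]⟩

lemma eVec_self {m : ℕ} {F : Type*} [Field F] (β : Fin m → F)
    (hne : ∀ i j, β i ≠ -β j) (i : Fin m) : (eVec β hne i : F → ZMod 3) (β i) = 1 := by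
  simp [eVec]

lemma eVec_ne {m : ℕ} {F : Type*} [Field F] (β : Fin m → F) (hinj : Function.Injective β)
    (hne : ∀ i j, β i ≠ -β j) (i j : Fin m) (h : j ≠ i) :
    (eVec β hne i : F → ZMod 3) (β j) = 0 := by
  simp [eVec, hne, hinj.ne h]

lemma eVec_equiv {m : ℕ} {K F : Type*} [Field K] [Field F] [Algebra K F] (β : Fin m → F)
    (hne : ∀ i j, β i ≠ -β j) (i j : Fin m) (σ : F ≃ₐ[K] F) (h : σ (β i) = β j) (α : F) :
    (eVec β hne j : F → ZMod 3) α = (eVec β hne i : F → ZMod 3) (σ.symm α) := by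
  have h1 : σ.symm α = β i ↔ α = β j := by
    rw [← h]
    exact σ.toEquiv.symm_apply_eq
  have h2 : σ.symm α = -β i ↔ α = -β j := by
    rw [← h, ← map_neg]
    exact σ.toEquiv.symm_apply_eq
  by_cases h3 : α = β j
  · simp only [eVec]
    rw [if_pos h3, if_pos (h1.2 h3)]
  · by_cases h4 : α = -β j
    · have h5 := h2.2 h4
      have h6 : ¬ σ.symm α = β i := fun h => h3 (h1.1 h)
      simp only [eVec]
      rw [if_neg h3, if_pos h4, if_neg h6, if_pos h5]
    · have h5 : ¬ σ.symm α = -β i := fun h => h4 (h2.1 h)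
      have h6 : ¬ σ.symm α = β i := fun h => h3 (h1.1 h)
      simp only [eVec]
      rw [if_neg h3, if_neg h4, if_neg h6, if_neg h5]

lemma eVec_sum {m : ℕ} {F : Type*} [Field F] (β : Fin m → F) (hinj : Function.Injective β)
    (hne : ∀ i j, β i ≠ -β j) (φ : VfMinus β) :
    φ = ∑ i, (φ : F → ZMod 3) (β i) • eVec β hne i := by
  apply VfMinus_ext
  intro j
  rw [Submodule.coe_sum, Finset.sum_apply, Finset.sum_eq_single j]
  · simp [eVec_self]
  · intro i _ hi
    simp [eVec_ne β hinj hne i j hi.symm]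
  · simp

end SignedPerm

open SignedPerm in
/-- if the Galois group of `h` is `2^{m-1}·G` (as a group of signed permutations
of the roots `±βᵢ`) for a doubly transitive `G ≤ Perm(Fin m)`, then every Galois-equivariant
𝔽₃-linear endomorphism of `V_f⁻` is multiplication by a scalar of `𝔽₃`. -/
theorem statement8 (K : Type*) [Field K] [CharZero K]
    (hζ : ∃ ζ : K, IsPrimitiveRoot ζ 3)
    (Kbar : Type*) [Field Kbar] [Algebra K Kbar] [IsAlgClosure K Kbar]
    (k m n : ℕ) (hm : m = 6 * k + 5) (hn : n = 2 * m + 1)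
    (f : Polynomial K) (hodd : f.comp (-Polynomial.X) = -f)
    (hdeg : f.natDegree = n) (hsq : Squarefree f)
    (β : Fin m → Kbar)
    (hroots : ∀ x : Kbar, Polynomial.aeval x f = 0 ↔ x = 0 ∨ ∃ i, x = β i ∨ x = -β i)
    (hinj : Function.Injective β) (hne : ∀ i j, β i ≠ -β j)
    (G : Subgroup (Equiv.Perm (Fin m)))
    (hG : ∀ a b c d : Fin m, a ≠ b → c ≠ d → ∃ g ∈ G, g a = c ∧ g b = d)
    (hgal1 : ∀ σ : Kbar ≃ₐ[K] Kbar, ∃ s ∈ G, ∃ ε : Fin m → Bool, signProd ε = 1 ∧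
        ∀ i, σ (β i) = (if ε i then -1 else 1) * β (s i))
    (hgal2 : ∀ s ∈ G, ∀ ε : Fin m → Bool, signProd ε = 1 →
        ∃ σ : Kbar ≃ₐ[K] Kbar, ∀ i, σ (β i) = (if ε i then -1 else 1) * β (s i))
    (T : VfMinus β →ₗ[ZMod 3] VfMinus β)
    (hT : ∀ σ : Kbar ≃ₐ[K] Kbar, ∀ φ ψ : VfMinus β,
        (∀ α, (ψ : Kbar → ZMod 3) α = (φ : Kbar → ZMod 3) (σ.symm α)) →
        ∀ α, (T ψ : Kbar → ZMod 3) α = (T φ : Kbar → ZMod 3) (σ.symm α)) :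
    ∃ c : ZMod 3, ∀ φ : VfMinus β, T φ = c • φ := by
  have hoff : ∀ i j, j ≠ i → (T (eVec β hne i) : Kbar → ZMod 3) (β j) = 0 := by
    intro i j hji
    obtain ⟨l, hl⟩ : ∃ l, l ∉ ({i, j} : Finset (Fin m)) := by
      by_contra! hcon
      have h1 := Finset.card_le_card (fun x _ => hcon x :
        (Finset.univ : Finset (Fin m)) ⊆ {i, j})
      have h2 := Finset.card_le_two (a := i) (b := j)
      rw [Finset.card_univ, Fintype.card_fin] at h1
      omega
    simp only [Finset.mem_insert, Finset.mem_singleton, not_or] at hl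
    obtain ⟨σ, hσ⟩ := hgal2 1 G.one_mem (fun x => xor (decide (x = j)) (decide (x = l))) (by
      rw [signProd_xor]
      simp [signProd])
    have hi : σ (β i) = β i := by
      rw [hσ i]
      simp [hji.symm, Ne.symm hl.1]
    have hj : σ (-β j) = β j := by
      rw [map_neg, hσ j]
      simp [Ne.symm hl.2]
    have h := hT σ _ _ (eVec_equiv β hne i i σ hi) (β j)
    have hj2 : σ.symm (β j) = -β j := by
      rw [← hj, AlgEquiv.symm_apply_apply, hj]
    rw [hj2, (T (eVec β hne i)).2.2 _ (Or.inr ⟨j, Or.inl rfl⟩)] at h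
    exact zmod3_eq_zero_of_eq_neg _ h
  have hdiag : ∀ i j, (T (eVec β hne i) : Kbar → ZMod 3) (β i)
      = (T (eVec β hne j) : Kbar → ZMod 3) (β j) := by
    intro i j
    by_cases hij : i = j
    · rw [hij]
    obtain ⟨g, hg, hgi, -⟩ := hG i j j i hij (Ne.symm hij)
    obtain ⟨σ, hσ⟩ := hgal2 g hg (fun _ => false) signProd_const_false
    have hi : σ (β i) = β j := by
      rw [hσ i, hgi]
      simp
    have h := hT σ _ _ (eVec_equiv β hne i j σ hi) (β j)
    rw [h, ← hi, AlgEquiv.symm_apply_apply]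
  have i0 : Fin m := ⟨0, by omega⟩
  refine ⟨(T (eVec β hne i0) : Kbar → ZMod 3) (β i0), fun φ => ?_⟩
  apply VfMinus_ext
  intro j
  conv_lhs => rw [eVec_sum β hinj hne φ]
  rw [map_sum, Submodule.coe_sum, Finset.sum_apply, Finset.sum_eq_single j]
  · simp [hdiag i0 j, mul_comm]
  · intro i _ hi
    simp [hoff i j hi.symm]
  · simp
end
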